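/- Let h : ℝ → ℝ be bounded measurable, vanishing outside [0,1], with ∫_0^1 h(v) dv = 0, define g(x) = ∫_0^x h(v) dv, and let α : ℝ → ℝ be bounded measurable and vanishing outside [0,1]. Then ∫_{−2}^{2} ψ_{g,h}(x) ψ_{α,α}(x) dx = 0. -/

import Mathlib

open Filter Set MeasureTheory

/-- `ψ_{α,β}(x) = ∫_0^1 ∫_{x+u−1}^{x+u+1} α(u) β(v) dv du`. -/
noncomputable def psi (α β : ℝ → ℝ) (x : ℝ) : ℝ :=
  ∫ u in (0:ℝ)..1, α u * ∫ v in (x + u - 1)..(x + u + 1), β v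

/-- An interval integral over `[0,1]` of a function vanishing off `[0,1]` is its integral over the
line. -/
theorem intervalIntegral_zero_one_eq_integral {f : ℝ → ℝ} (hf : ∀ x, x ∉ Set.Icc (0:ℝ) 1 → f x = 0) :
    ∫ x in (0:ℝ)..1, f x = ∫ x, f x := by
  rw [intervalIntegral.integral_of_le zero_le_one, ← integral_Icc_eq_integral_Ioc,
    setIntegral_eq_integral_of_forall_compl_eq_zero hf]

/-- A bounded measurable function vanishing off `[0,1]` is integrable. -/
theorem integrable_of_bounded_of_support_Icc {f : ℝ → ℝ} (hm : Measurable f)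
    (hb : ∃ M : ℝ, ∀ x, |f x| ≤ M) (h0 : ∀ x, x ∉ Set.Icc (0:ℝ) 1 → f x = 0) :
    Integrable f := by
  obtain ⟨M, hM⟩ := hb
  have hon : IntegrableOn f (Set.Icc (0:ℝ) 1) :=
    Measure.integrableOn_of_bounded (M := M) (by simp) hm.aestronglyMeasurable
      (Eventually.of_forall hM)
  rwa [integrableOn_iff_integrable_of_support_subset] at hon
  intro x hx
  by_contra hx'
  exact hx (h0 x hx')

/-- `psi α β` as an iterated integral of `α ⊗ β` over the strip `|v - u - x| ≤ 1`. -/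
theorem psi_eq_integral_indicator {α β : ℝ → ℝ} (hα0 : ∀ x, x ∉ Set.Icc (0:ℝ) 1 → α x = 0)
    (x : ℝ) :
    psi α β x = ∫ u, ∫ v, {p : ℝ × ℝ | |p.2 - p.1 - x| ≤ 1}.indicator
      (fun p => α p.1 * β p.2) (u, v) := by
  rw [psi, intervalIntegral_zero_one_eq_integral (fun u hu => by simp [hα0 u hu])]
  congr 1
  ext u
  rw [intervalIntegral.integral_of_le (by linarith), ← integral_Icc_eq_integral_Ioc,
    ← integral_indicator measurableSet_Icc, ← integral_const_mul]
  congr 1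
  ext v
  have hiff : v ∈ Set.Icc (x + u - 1) (x + u + 1) ↔
      (u, v) ∈ {p : ℝ × ℝ | |p.2 - p.1 - x| ≤ 1} := by
    simp only [Set.mem_Icc, Set.mem_ofPred_eq, abs_le]
    constructor <;> rintro ⟨h1, h2⟩ <;> constructor <;> linarith
  by_cases hv : v ∈ Set.Icc (x + u - 1) (x + u + 1)
  · rw [Set.indicator_of_mem hv, Set.indicator_of_mem (hiff.1 hv)]
  · rw [Set.indicator_of_notMem hv, Set.indicator_of_notMem (mt hiff.2 hv), mul_zero]

theorem psi_neg {α β : ℝ → ℝ} (hα : Integrable α) (hβ : Integrable β)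
    (hα0 : ∀ x, x ∉ Set.Icc (0:ℝ) 1 → α x = 0) (hβ0 : ∀ x, x ∉ Set.Icc (0:ℝ) 1 → β x = 0)
    (x : ℝ) : psi α β (-x) = psi β α x := by
  have hS : MeasurableSet {p : ℝ × ℝ | |p.2 - p.1 - -x| ≤ 1} :=
    measurableSet_le (by fun_prop) measurable_const
  rw [psi_eq_integral_indicator hα0, psi_eq_integral_indicator hβ0,
    integral_integral_swap (f := fun u v => {p : ℝ × ℝ | |p.2 - p.1 - -x| ≤ 1}.indicator
      (fun p => α p.1 * β p.2) (u, v)) ((hα.mul_prod hβ).indicator hS)]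
  congr 1
  ext v
  congr 1
  ext u
  have hiff : (u, v) ∈ {p : ℝ × ℝ | |p.2 - p.1 - -x| ≤ 1} ↔
      (v, u) ∈ {p : ℝ × ℝ | |p.2 - p.1 - x| ≤ 1} := by
    simp only [Set.mem_ofPred_eq]
    rw [← abs_neg]
    ring_nf
  by_cases hv : (u, v) ∈ {p : ℝ × ℝ | |p.2 - p.1 - -x| ≤ 1}
  · rw [Set.indicator_of_mem hv, Set.indicator_of_mem (hiff.1 hv), mul_comm]
  · rw [Set.indicator_of_notMem hv, Set.indicator_of_notMem (mt hiff.2 hv)]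

/-- The primitive of an integrable function supported in `[0,1]` with zero mean vanishes off
`[0,1]`. -/
theorem primitive_eq_zero_of_notMem_Icc {h : ℝ → ℝ} (hh : Integrable h)
    (hh0 : ∀ x, x ∉ Set.Icc (0:ℝ) 1 → h x = 0) (hhint : (∫ v in (0:ℝ)..1, h v) = 0)
    (x : ℝ) (hx : x ∉ Set.Icc (0:ℝ) 1) : ∫ v in (0:ℝ)..x, h v = 0 := by
  rcases lt_or_ge x 0 with h0 | h0
  · rw [intervalIntegral.integral_symm, intervalIntegral.integral_of_le h0.le,
      integral_Ioc_eq_integral_Ioo, setIntegral_eq_zero_of_forall_eq_zero, neg_zero]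
    exact fun v hv => hh0 v fun hv' => absurd hv.2 (not_lt.2 hv'.1)
  · have h1 : 1 < x := by
      by_contra h1
      exact hx ⟨h0, not_lt.1 h1⟩
    rw [← intervalIntegral.integral_add_adjacent_intervals (b := 1) hh.intervalIntegrable
      hh.intervalIntegrable, hhint, intervalIntegral.integral_of_le h1.le,
      setIntegral_eq_zero_of_forall_eq_zero, add_zero]
    exact fun v hv => hh0 v fun hv' => absurd hv.1 (not_lt.2 hv'.2)

/-- The autocorrelation `t ↦ ∫ g(u) g(u + t) du` is even. -/
theorem integral_mul_add_neg (g : ℝ → ℝ) (t : ℝ) :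
    ∫ u, g u * g (u + -t) = ∫ u, g u * g (u + t) := by
  rw [← integral_add_right_eq_self (fun u => g u * g (u + -t)) t]
  congr 1
  ext u
  rw [add_neg_cancel_right, mul_comm]

/-- If `g` is a continuous primitive of `h` vanishing off `[0,1]`, then `psi g h` is a difference
of autocorrelations of `g`. -/
theorem psi_primitive {g h : ℝ → ℝ} (hh : Integrable h) (hg : ∀ x : ℝ, g x = ∫ v in (0:ℝ)..x, h v)
    (hgc : Continuous g) (hg0 : ∀ x, x ∉ Set.Icc (0:ℝ) 1 → g x = 0) (x : ℝ) :
    psi g h x = (∫ u, g u * g (u + (x + 1))) - ∫ u, g u * g (u + (x - 1)) := by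
  have hgs : HasCompactSupport g := HasCompactSupport.intro isCompact_Icc hg0
  have hint (t : ℝ) : Integrable fun u => g u * g (u + t) :=
    (hgc.mul (hgc.comp (continuous_add_const t))).integrable_of_hasCompactSupport hgs.mul_right
  rw [psi, intervalIntegral_zero_one_eq_integral (fun u hu => by simp [hg0 u hu]),
    ← integral_sub (hint _) (hint _)]
  congr 1
  ext u
  rw [← mul_sub, hg (u + (x + 1)), hg (u + (x - 1)),
    intervalIntegral.integral_interval_sub_left hh.intervalIntegrable hh.intervalIntegrable]
  ring_nf

theorem psi_primitive_neg {g h : ℝ → ℝ} (hh : Integrable h)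
    (hg : ∀ x : ℝ, g x = ∫ v in (0:ℝ)..x, h v)
    (hgc : Continuous g) (hg0 : ∀ x, x ∉ Set.Icc (0:ℝ) 1 → g x = 0) (x : ℝ) :
    psi g h (-x) = -psi g h x := by
  rw [psi_primitive hh hg hgc hg0, psi_primitive hh hg hgc hg0,
    show -x + 1 = -(x - 1) by ring, show -x - 1 = -(x + 1) by ring,
    integral_mul_add_neg, integral_mul_add_neg, neg_sub]

/-- with `h` bounded measurable vanishing outside `[0,1]`, `∫_0^1 h = 0`,
`g(x) = ∫_0^x h(v) dv`, and `α` bounded measurable vanishing outside `[0,1]`, one has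
`∫_{−2}^{2} ψ_{g,h}(x) ψ_{α,α}(x) dx = 0`. -/
theorem stmt13 (h g α : ℝ → ℝ)
    (hhm : Measurable h) (hhb : ∃ M : ℝ, ∀ x, |h x| ≤ M)
    (hh0 : ∀ x, x ∉ Set.Icc (0:ℝ) 1 → h x = 0)
    (hhint : (∫ v in (0:ℝ)..1, h v) = 0)
    (hg : ∀ x : ℝ, g x = ∫ v in (0:ℝ)..x, h v)
    (hαm : Measurable α) (hαb : ∃ M : ℝ, ∀ x, |α x| ≤ M)
    (hα0 : ∀ x, x ∉ Set.Icc (0:ℝ) 1 → α x = 0) :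
    ∫ x in (-2:ℝ)..2, psi g h x * psi α α x = 0 := by
  have hh : Integrable h := integrable_of_bounded_of_support_Icc hhm hhb hh0
  have hα : Integrable α := integrable_of_bounded_of_support_Icc hαm hαb hα0
  have hgc : Continuous g := by
    rw [funext hg]
    exact intervalIntegral.continuous_primitive (fun _ _ => hh.intervalIntegrable) 0
  have hg0 : ∀ x, x ∉ Set.Icc (0:ℝ) 1 → g x = 0 := fun x hx =>
    (hg x).trans (primitive_eq_zero_of_notMem_Icc hh hh0 hhint x hx)
  have hodd := intervalIntegral.integral_comp_neg (a := -2) (b := 2)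
    (fun x => psi g h x * psi α α x)
  simp only [psi_primitive_neg hh hg hgc hg0, psi_neg hα hα hα0 hα0, neg_mul,
    intervalIntegral.integral_neg, neg_neg] at hodd
  linarith
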